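/- arXiv:2507.20458 — 2 statements merged into one kernel-verified Lean document; each statement's English description precedes it below -/
import Mathlib

section
/- Let C be a product-complete self-orthogonal right R-module and n ≥ 0. If N is a right R-module with Ext^i_R(C, N) = 0 for all i ≥ 1 and there is an exact sequence 0 → N → C⁰ → ··· → Cⁿ → 0 with each C^i ∈ Add(C), then N ∈ Add(C). Dually, if M satisfies Ext^i_R(M, C) = 0 for all i ≥ 1 and admits an exact sequence 0 → Cₙ → ··· → C₀ → M → 0 with each C_i ∈ Add(C), then M ∈ Add(C). -/
/-!
STATEMENT 5 (Lemma 3.3(ii)): Let C be a product-complete self-orthogonal right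
R-module (right R-modules are modeled as `Rᵐᵒᵖ`-modules) and n ≥ 0.
(1) If N satisfies Ext^i_R(C, N) = 0 for all i ≥ 1 and admits an exact sequence
    0 → N → C⁰ → ⋯ → Cⁿ → 0 with each Cⁱ ∈ Add(C), then N ∈ Add(C).
(2) Dually, if M satisfies Ext^i_R(M, C) = 0 for all i ≥ 1 and admits an exact
    sequence 0 → Cₙ → ⋯ → C₀ → M → 0 with each Cᵢ ∈ Add(C), then M ∈ Add(C).
Encodings of the exact sequences are as in the other files: modules `D 0, …, D (n+1)`
with maps `d i : D i ⟶ D (i+1)`, injective first map, surjective last map, and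
exactness in between.
-/

open CategoryTheory Opposite

/-- `extM A i X Y` is the Ext group `Ext^i_A(X, Y)` in the category of `A`-modules. -/
noncomputable def extM (A : Type) [Ring A] (i : ℕ) (X Y : ModuleCat.{0} A) : ModuleCat.{0} ℤ :=
  ((Ext ℤ (ModuleCat.{0} A) i).obj (op X)).obj Y

/-- `N ∈ Add(C)`: `N` is a direct summand of a (possibly infinite) direct sum of
copies of `C`. -/
def memADD (A : Type) [Ring A] (C : Type) [AddCommGroup C] [Module A C]
    (N : ModuleCat.{0} A) : Prop :=
  ∃ (ι : Type) (s : N →ₗ[A] (ι →₀ C)) (r : (ι →₀ C) →ₗ[A] N),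
    r ∘ₗ s = LinearMap.id

/-- `N ∈ Prod(C)`: `N` is a direct summand of a direct product of copies of `C`. -/
def memProd (A : Type) [Ring A] (C : Type) [AddCommGroup C] [Module A C]
    (N : ModuleCat.{0} A) : Prop :=
  ∃ (ι : Type) (s : N →ₗ[A] (ι → C)) (r : (ι → C) →ₗ[A] N),
    r ∘ₗ s = LinearMap.id

/-- `C` is product-complete if `Prod(C) ⊆ Add(C)`. -/
def ProductComplete (A : Type) [Ring A] (C : Type) [AddCommGroup C] [Module A C] : Prop :=
  ∀ N : ModuleCat.{0} A, memProd A C N → memADD A C N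

/-- Vanishing of cohomology in positive degrees, computed with a fixed projective resolution. -/
def cocycVan {A : Type} [Ring A] {X : ModuleCat.{0} A} (P : ProjectiveResolution X)
    (Y : ModuleCat.{0} A) : Prop :=
  ∀ (i : ℕ) (f : P.complex.X (i + 1) ⟶ Y), P.complex.d (i + 2) (i + 1) ≫ f = 0 →
    ∃ g : P.complex.X i ⟶ Y, P.complex.d (i + 1) i ≫ g = f

theorem cocycVan_of_ext {A : Type} [Ring A] {X : ModuleCat.{0} A} (P : ProjectiveResolution X)
    (Y : ModuleCat.{0} A) (h : ∀ i, 1 ≤ i → Subsingleton (extM A i X Y)) : cocycVan P Y := by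
  intro i f hf
  have h1 := h (i + 1) (by omega)
  have hz : Limits.IsZero (extM A (i + 1) X Y) := ModuleCat.isZero_of_subsingleton _
  have hz2 := Limits.IsZero.of_iso hz (P.isoExt (R := ℤ) (i + 1) Y).symm
  rw [← HomologicalComplex.exactAt_iff_isZero_homology,
    HomologicalComplex.exactAt_iff' _ i (i + 1) (i + 2) (by simp) (by simp)] at hz2
  rw [ShortComplex.moduleCat_exact_iff] at hz2
  obtain ⟨g, hg⟩ := hz2 f hf
  exact ⟨g, hg⟩

/-- Dimension shifting. -/
theorem cocycVan_shift {A : Type} [Ring A] {X : ModuleCat.{0} A} (P : ProjectiveResolution X)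
    {K B D : ModuleCat.{0} A} (a : K ⟶ B) (b : B ⟶ D) (ha : Function.Injective a)
    (hb : Function.Surjective b) (hab : Function.Exact a b)
    (hK : cocycVan P K) (hB : cocycVan P B) : cocycVan P D := by
  have : Mono a := (ModuleCat.mono_iff_injective a).2 ha
  have : Epi b := (ModuleCat.epi_iff_surjective b).2 hb
  have w : a ≫ b = 0 := by ext x; exact hab.apply_apply_eq_zero x
  have hex : (ShortComplex.mk a b w).Exact := by
    rw [ShortComplex.moduleCat_exact_iff]; exact fun x hx => (hab x).1 hx
  intro i z hz
  have := P.projective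
  let l : P.complex.X (i + 1) ⟶ B := Projective.factorThru z b
  have hl : l ≫ b = z := Projective.factorThru_comp z b
  have h0 : (P.complex.d (i + 2) (i + 1) ≫ l) ≫ b = 0 := by
    rw [Category.assoc, hl, hz]
  let y := hex.lift (P.complex.d (i + 2) (i + 1) ≫ l) h0
  have hy : y ≫ a = P.complex.d (i + 2) (i + 1) ≫ l := hex.lift_f _ h0
  obtain ⟨v, hv⟩ := hK (i + 1) y (by
    rw [← cancel_mono a, Category.assoc, hy, ← Category.assoc, P.complex.d_comp_d]; simp)
  obtain ⟨u, hu⟩ := hB i (l - v ≫ a) (by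
    rw [Preadditive.comp_sub, ← Category.assoc, hv, hy, sub_self])
  refine ⟨u ≫ b, ?_⟩
  rw [← Category.assoc, hu, Preadditive.sub_comp, Category.assoc, w, hl]; simp

/-- Lifting of homomorphisms out of `X`. -/
theorem cocycVan_lift {A : Type} [Ring A] {X : ModuleCat.{0} A} (P : ProjectiveResolution X)
    {K B D : ModuleCat.{0} A} (a : K ⟶ B) (b : B ⟶ D) (ha : Function.Injective a)
    (hb : Function.Surjective b) (hab : Function.Exact a b)
    (hK : cocycVan P K) (t : X ⟶ D) : ∃ s : X ⟶ B, s ≫ b = t := by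
  have : Mono a := (ModuleCat.mono_iff_injective a).2 ha
  have : Epi b := (ModuleCat.epi_iff_surjective b).2 hb
  have w : a ≫ b = 0 := by ext x; exact hab.apply_apply_eq_zero x
  have hex : (ShortComplex.mk a b w).Exact := by
    rw [ShortComplex.moduleCat_exact_iff]; exact fun x hx => (hab x).1 hx
  have := P.projective
  let p : P.complex.X 0 ⟶ X := P.π.f 0
  have hp : P.complex.d 1 0 ≫ p = 0 := P.complex_d_comp_π_f_zero
  let l : P.complex.X 0 ⟶ B := Projective.factorThru (p ≫ t) b
  have hl : l ≫ b = p ≫ t := Projective.factorThru_comp _ b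
  have h0 : (P.complex.d 1 0 ≫ l) ≫ b = 0 := by
    rw [Category.assoc, hl, ← Category.assoc, hp, Limits.zero_comp]
  let y := hex.lift (P.complex.d 1 0 ≫ l) h0
  have hy : y ≫ a = P.complex.d 1 0 ≫ l := hex.lift_f _ h0
  obtain ⟨v, hv⟩ := hK 0 y (by
    rw [← cancel_mono a, Category.assoc, hy, ← Category.assoc, P.complex.d_comp_d]; simp)
  have hq : P.complex.d 1 0 ≫ (l - v ≫ a) = 0 := by
    rw [Preadditive.comp_sub, ← Category.assoc, hv, hy, sub_self]
  have hep : Epi p := inferInstanceAs (Epi (P.π.f 0))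
  let s : X ⟶ B := P.exact₀.desc (l - v ≫ a) hq
  have hs : p ≫ s = l - v ≫ a := P.exact₀.g_desc _ hq
  refine ⟨s, ?_⟩
  rw [← cancel_epi p, ← Category.assoc, hs, Preadditive.sub_comp, Category.assoc, w, hl]; simp

theorem cocycVan_retract {A : Type} [Ring A] {X : ModuleCat.{0} A} (P : ProjectiveResolution X)
    {Y Z : ModuleCat.{0} A} (s : Y →ₗ[A] Z) (r : Z →ₗ[A] Y) (h : r ∘ₗ s = LinearMap.id)
    (hZ : cocycVan P Z) : cocycVan P Y := by
  intro i f hf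
  obtain ⟨g, hg⟩ := hZ i (f ≫ ModuleCat.ofHom s) (by rw [← Category.assoc, hf, Limits.zero_comp])
  refine ⟨g ≫ ModuleCat.ofHom r, ?_⟩
  rw [← Category.assoc, hg, Category.assoc]
  have : ModuleCat.ofHom s ≫ ModuleCat.ofHom r = 𝟙 Y := by
    rw [← ModuleCat.ofHom_comp, h]; rfl
  rw [this, Category.comp_id]

theorem cocycVan_pi {A : Type} [Ring A] {X : ModuleCat.{0} A} (P : ProjectiveResolution X)
    (C : Type) [AddCommGroup C] [Module A C] (I : Type)
    (hC : cocycVan P (ModuleCat.of A C)) : cocycVan P (ModuleCat.of A (I → C)) := by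
  intro i f hf
  have hc : ∀ j : I, ∃ g : P.complex.X i ⟶ ModuleCat.of A C, P.complex.d (i + 1) i ≫ g =
      f ≫ ModuleCat.ofHom (LinearMap.proj (R := A) (φ := fun _ : I => C) j) := by
    intro j
    exact hC i _ (by rw [← Category.assoc, hf, Limits.zero_comp])
  choose g hg using hc
  refine ⟨ModuleCat.ofHom (LinearMap.pi fun j => (g j).hom), ?_⟩
  ext x j
  have := ConcreteCategory.congr_hom (hg j) x
  exact this

theorem cocycVan_of_subsingleton {A : Type} [Ring A] {X : ModuleCat.{0} A}
    (P : ProjectiveResolution X) (Y : ModuleCat.{0} A) [Subsingleton Y] : cocycVan P Y := by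
  intro i f _
  refine ⟨0, ?_⟩
  ext x
  exact Subsingleton.elim (α := Y) _ _

/-- A Chase-type lemma: a strictly decreasing chain of subgroups cannot be compatible with a split
embedding of a large power of `C` into a direct sum of copies of `C`. -/
theorem chase_aux {C : Type} [AddCommGroup C] (G : ℕ → AddSubgroup C) (hG : StrictAnti G)
    {K : Type} (f : (ℕ × List C → C) →+ (K →₀ C)) (r : (K →₀ C) →+ (ℕ × List C → C))
    (hrf : ∀ x, r (f x) = x)
    (hf : ∀ n x, (∀ i, x i ∈ G n) → ∀ k, f x k ∈ G n)
    (hr : ∀ n y, (∀ k, y k ∈ G n) → ∀ i, r y i ∈ G n) : False := by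
  classical
  have ha : ∀ m, ∃ a, a ∈ G m ∧ a ∉ G (m + 1) := fun m =>
    SetLike.exists_of_lt (hG (Nat.lt_succ_self m))
  choose a ha1 ha2 using ha
  let x : ℕ → Set (List C) → (ℕ × List C → C) := fun m S p =>
    if p.1 = m ∧ p.2 ∈ S then a m else 0
  have key : ∀ (m : ℕ) (F : Finset K), ∃ (S : Set (List C)) (k : K), k ∉ F ∧
      f (x m S) k ∉ G (m + 1) := by
    intro m F
    by_contra hcon
    push Not at hcon
    let e : Set (List C) → List C := fun S => F.toList.map (f (x m S))
    apply Function.cantor_injective e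
    intro S T hST
    have h1 : ∀ k ∈ F, f (x m S) k = f (x m T) k := by
      intro k hk
      exact List.map_inj_left.1 hST k (Finset.mem_toList.2 hk)
    have h2 : ∀ k, f (x m S - x m T) k ∈ G (m + 1) := by
      intro k
      rw [map_sub, Finsupp.sub_apply]
      by_cases hk : k ∈ F
      · rw [h1 k hk, sub_self]; exact zero_mem _
      · exact sub_mem (hcon S k hk) (hcon T k hk)
    have h3 := hr (m + 1) _ h2
    rw [hrf] at h3
    ext l
    have h4 := h3 (m, l)
    by_cases hS : l ∈ S <;> by_cases hT : l ∈ T <;> simp [x, hS, hT, ha2] at h4 ⊢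
  choose S k hk1 hk2 using key
  let F : ℕ → Finset K := fun m => Nat.rec ∅ (fun m F => F ∪ (f (x m (S m F))).support) m
  have hF : ∀ m, F (m + 1) = F m ∪ (f (x m (S m (F m)))).support := fun m => rfl
  have hFmono : Monotone F := monotone_nat_of_le_succ fun m => by
    rw [hF]; exact Finset.subset_union_left
  let xs : ℕ → (ℕ × List C → C) := fun m => x m (S m (F m))
  let ks : ℕ → K := fun m => k m (F m)
  let X : ℕ × List C → C := fun p => xs p.1 p
  have hX : ∀ m, f X (ks m) ∉ G (m + 1) := by
    intro m hm
    have htail : ∀ i, (X - ∑ j ∈ Finset.range (m + 1), xs j) i ∈ G (m + 1) := by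
      rintro ⟨q, l⟩
      rw [Pi.sub_apply, Finset.sum_apply]
      by_cases hq : q < m + 1
      · rw [Finset.sum_eq_single_of_mem q (Finset.mem_range.2 hq)]
        · simp [X]
        · intro j _ hj
          simp [xs, x, hj.symm]
      · rw [Finset.sum_eq_zero]
        · rw [sub_zero]
          simp only [X, xs, x]
          split_ifs
          · exact hG.antitone (by omega : m + 1 ≤ q) (ha1 q)
          · exact zero_mem _
        · intro j hj
          have : q ≠ j := by rw [Finset.mem_range] at hj; omega
          simp [xs, x, this]
    have h1 := hf _ _ htail (ks m)
    rw [map_sub, Finsupp.sub_apply, map_sum, Finset.sum_range_succ, Finsupp.add_apply,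
      Finsupp.finsetSum_apply, Finset.sum_eq_zero, zero_add] at h1
    · apply hk2 m (F m)
      have := sub_mem hm h1
      rwa [sub_sub_cancel] at this
    · intro j hj
      by_contra hne
      apply hk1 m (F m)
      apply hFmono (Finset.mem_range.1 hj : j + 1 ≤ m)
      rw [hF]
      exact Finset.mem_union_right _ (Finsupp.mem_support_iff.2 hne)
  have hinj : Function.Injective ks := by
    suffices hlt : ∀ i j, i < j → ks i ≠ ks j by
      intro i j hij
      rcases lt_trichotomy i j with h | h | h
      · exact absurd hij (hlt i j h)
      · exact h
      · exact absurd hij.symm (hlt j i h)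
    intro i j hij heq
    apply hk1 j (F j)
    apply hFmono (hij : i + 1 ≤ j)
    rw [hF]
    apply Finset.mem_union_right
    rw [Finsupp.mem_support_iff]
    intro h0
    apply hk2 i (F i)
    have h0' : f (x i (S i (F i))) (ks i) = 0 := by rw [heq]; exact h0
    have : f (x i (S i (F i))) (k i (F i)) = 0 := h0'
    rw [this]; exact zero_mem _
  have hfin : Set.Finite (Set.range ks) := by
    apply (f X).support.finite_toSet.subset
    rintro _ ⟨m, rfl⟩
    rw [Finset.mem_coe, Finsupp.mem_support_iff]
    intro h0
    apply hX m
    rw [h0]; exact zero_mem _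
  exact Set.infinite_range_of_injective hinj hfin

/-- Values at `b` of the homomorphisms `N → M` vanishing on `T`. -/
def valSub (A : Type) [Ring A] {N : Type} [AddCommGroup N] [Module A N] (T : Set N) (b : N)
    (M : Type) [AddCommGroup M] [Module A M] : AddSubgroup M where
  carrier := {m | ∃ h : N →ₗ[A] M, (∀ t ∈ T, h t = 0) ∧ h b = m}
  zero_mem' := ⟨0, by simp, by simp⟩
  add_mem' := by
    rintro _ _ ⟨h, h1, rfl⟩ ⟨g, g1, rfl⟩
    exact ⟨h + g, fun t ht => by simp [h1 t ht, g1 t ht], by simp⟩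
  neg_mem' := by
    rintro _ ⟨h, h1, rfl⟩
    exact ⟨-h, fun t ht => by simp [h1 t ht], by simp⟩

section
variable {A : Type} [Ring A] {N : Type} [AddCommGroup N] [Module A N] (T : Set N) (b : N)
  {C : Type} [AddCommGroup C] [Module A C]

theorem valSub_map {M M' : Type} [AddCommGroup M] [Module A M] [AddCommGroup M'] [Module A M']
    (f : M →ₗ[A] M') {m : M} (hm : m ∈ valSub A T b M) : f m ∈ valSub A T b M' := by
  obtain ⟨h, h1, rfl⟩ := hm
  exact ⟨f ∘ₗ h, fun t ht => by simp [h1 t ht], rfl⟩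

theorem valSub_pi {I : Type} (c : I → C) :
    c ∈ valSub A T b (I → C) ↔ ∀ i, c i ∈ valSub A T b C := by
  constructor
  · intro h i
    exact valSub_map T b (LinearMap.proj (R := A) (φ := fun _ : I => C) i) h
  · intro h
    choose g hg1 hg2 using h
    exact ⟨LinearMap.pi g, fun t ht => funext fun i => hg1 i t ht, funext hg2⟩

theorem valSub_finsupp {I : Type} (c : I →₀ C) :
    c ∈ valSub A T b (I →₀ C) ↔ ∀ i, c i ∈ valSub A T b C := by
  constructor
  · intro h i
    exact valSub_map T b (Finsupp.lapply (R := A) i) h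
  · intro h
    rw [← Finsupp.sum_single c]
    exact sum_mem fun i _ => valSub_map T b (Finsupp.lsingle (R := A) i) (h i)

/-- Product-completeness gives the descending chain condition. -/
theorem valSub_dcc (hpc : ProductComplete A C) (T : ℕ → Set N)
    (h : StrictAnti fun n => valSub A (T n) b C) : False := by
  obtain ⟨K, s, r, hrs⟩ := hpc (ModuleCat.of A (ℕ × List C → C))
    ⟨ℕ × List C, LinearMap.id, LinearMap.id, rfl⟩
  refine chase_aux _ h (K := K) s.toAddMonoidHom r.toAddMonoidHom ?_ ?_ ?_
  · intro x
    exact LinearMap.congr_fun hrs x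
  · intro n x hx
    exact (valSub_finsupp (T n) b _).1 (valSub_map (T n) b s ((valSub_pi (T n) b x).2 hx))
  · intro n x hx
    exact (valSub_pi (T n) b _).1 (valSub_map (T n) b r ((valSub_finsupp (T n) b x).2 hx))

end

/-- The direct sum splits off the direct product. -/
theorem sum_split {A : Type} [Ring A] {C : Type} [AddCommGroup C] [Module A C]
    (hpc : ProductComplete A C) (J : Type) :
    ∃ r : (J → C) →ₗ[A] (J →₀ C), ∀ m : J →₀ C, r m = m := by
  classical
  let good : Set ((J → C) × (J →₀ C)) → Prop := fun G =>
    ∀ T : Finset ((J → C) × (J →₀ C)), (T : Set _) ⊆ G →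
      ∃ h : (J → C) →ₗ[A] (J →₀ C), ∀ p ∈ T, h p.1 = p.2
  have h0 : good (Set.range fun m : J →₀ C => ((m : J → C), m)) := by
    intro T hT
    let F : Finset J := T.biUnion fun p => p.2.support
    let h : (J → C) →ₗ[A] (J →₀ C) :=
      ∑ j ∈ F, (Finsupp.lsingle (R := A) j) ∘ₗ (LinearMap.proj (R := A) (φ := fun _ : J => C) j)
    refine ⟨h, fun p hp => ?_⟩
    obtain ⟨m, rfl⟩ := hT hp
    have hm : m.support ⊆ F := fun j hj => Finset.mem_biUnion.2 ⟨_, hp, hj⟩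
    have : h m = ∑ j ∈ F, Finsupp.single j (m j) := by simp [h]
    change h m = m
    rw [this]
    conv_rhs => rw [← Finsupp.sum_single m]
    exact (Finsupp.sum_of_support_subset m hm _ (by simp)).symm
  obtain ⟨G, hG0, hG⟩ := zorn_subset_nonempty {G | good G} (by
    intro c hc hch hne
    refine ⟨⋃₀ c, ?_, fun s hs => Set.subset_sUnion_of_mem hs⟩
    intro T hT
    obtain ⟨s, hs, hTs⟩ := hch.directedOn.exists_mem_subset_of_finset_subset_biUnion
      (f := id) hne (s := T) (by simpa [Set.sUnion_eq_biUnion] using hT)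
    exact hc hs T hTs) _ h0
  have hgood : good G := hG.prop
  have htotal : ∀ b : J → C, ∃ c, (b, c) ∈ G := by
    intro b
    have hmin : ∃ T : Finset ((J → C) × (J →₀ C)), (T : Set _) ⊆ G ∧
        ∀ T' : Finset ((J → C) × (J →₀ C)), (T' : Set _) ⊆ G →
        ¬ valSub A (Prod.fst '' (T' : Set ((J → C) × (J →₀ C)))) b C <
          valSub A (Prod.fst '' (T : Set ((J → C) × (J →₀ C)))) b C := by
      by_contra hcon
      push Not at hcon
      choose! nx hnx1 hnx2 using hcon
      let Ts : ℕ → Finset ((J → C) × (J →₀ C)) := fun n => nx^[n] ∅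
      have hTs : ∀ n, (Ts n : Set _) ⊆ G := by
        intro n
        induction n with
        | zero => simp [Ts]
        | succ n ih =>
          simp only [Ts, Function.iterate_succ_apply']
          exact hnx1 _ ih
      apply valSub_dcc b hpc (fun n => Prod.fst '' (Ts n : Set ((J → C) × (J →₀ C))))
      apply strictAnti_nat_of_succ_lt
      intro n
      have := hnx2 _ (hTs n)
      simpa only [Ts, Function.iterate_succ_apply'] using this
    obtain ⟨T, hTG, hT⟩ := hmin
    obtain ⟨g, hg⟩ := hgood T hTG
    have hext : ∀ T' : Finset ((J → C) × (J →₀ C)), (T' : Set _) ⊆ G →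
        ∃ h : (J → C) →ₗ[A] (J →₀ C), (∀ p ∈ T', h p.1 = p.2) ∧ h b = g b := by
      intro T' hT'
      have hU : ((T ∪ T' : Finset _) : Set _) ⊆ G := by
        rw [Finset.coe_union]; exact Set.union_subset hTG hT'
      obtain ⟨g1, hg1⟩ := hgood _ hU
      have hle : valSub A (Prod.fst '' ((T ∪ T' : Finset _) : Set ((J → C) × (J →₀ C)))) b C ≤
          valSub A (Prod.fst '' (T : Set ((J → C) × (J →₀ C)))) b C := by
        rintro _ ⟨h, hh, rfl⟩
        refine ⟨h, fun t ht => hh t ?_, rfl⟩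
        exact Set.image_mono (by rw [Finset.coe_union]; exact Set.subset_union_left) ht
      have heq := eq_of_le_of_not_lt hle (hT _ hU)
      have hd : g b - g1 b ∈ valSub A (Prod.fst '' (T : Set ((J → C) × (J →₀ C)))) b (J →₀ C) := by
        refine ⟨g - g1, ?_, rfl⟩
        rintro _ ⟨p, hp, rfl⟩
        rw [LinearMap.sub_apply, hg p hp, hg1 p (Finset.mem_union_left _ hp), sub_self]
      rw [valSub_finsupp, ← heq, ← valSub_finsupp] at hd
      obtain ⟨g2, hg2, hg2b⟩ := hd
      refine ⟨g1 + g2, fun p hp => ?_, ?_⟩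
      · have hp' : p ∈ T ∪ T' := Finset.mem_union_right _ hp
        rw [LinearMap.add_apply, hg1 p hp', hg2 _ ⟨p, hp', rfl⟩, add_zero]
      · rw [LinearMap.add_apply, hg2b]; abel
    refine ⟨g b, ?_⟩
    have hins : good (insert (b, g b) G) := by
      intro T' hT'
      obtain ⟨h, hh, hb⟩ := hext (T'.erase (b, g b)) (by
        intro p hp
        rw [Finset.mem_coe, Finset.mem_erase] at hp
        exact (hT' hp.2).resolve_left hp.1)
      refine ⟨h, fun p hp => ?_⟩
      by_cases hpe : p = (b, g b)
      · subst hpe; exact hb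
      · exact hh p (Finset.mem_erase.2 ⟨hpe, hp⟩)
    exact hG.le_of_ge hins (Set.subset_insert _ _) (Set.mem_insert _ _)
  choose φ hφ using htotal
  have hrel : ∀ T : Finset (J → C), ∃ h : (J → C) →ₗ[A] (J →₀ C), ∀ x ∈ T, h x = φ x := by
    intro T
    obtain ⟨h, hh⟩ := hgood (T.image fun x => (x, φ x)) (by
      intro p hp
      obtain ⟨x, _, rfl⟩ := Finset.mem_image.1 (Finset.mem_coe.1 hp)
      exact hφ x)
    exact ⟨h, fun x hx => hh _ (Finset.mem_image_of_mem _ hx)⟩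
  refine ⟨{ toFun := φ, map_add' := ?_, map_smul' := ?_ }, ?_⟩
  · intro x y
    obtain ⟨h, hh⟩ := hrel {x, y, x + y}
    rw [← hh x (by simp), ← hh y (by simp), ← hh (x + y) (by simp), map_add]
  · intro a x
    obtain ⟨h, hh⟩ := hrel {x, a • x}
    rw [← hh x (by simp), ← hh (a • x) (by simp), map_smul]; rfl
  · intro m
    obtain ⟨h, hh⟩ := hgood {((m : J → C), φ m), ((m : J → C), m)} (by
      intro p hp
      rw [Finset.mem_coe, Finset.mem_insert, Finset.mem_singleton] at hp
      rcases hp with rfl | rfl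
      · exact hφ _
      · exact hG0 ⟨m, rfl⟩)
    have h1 := hh ((m : J → C), φ m) (by simp)
    have h2 := hh ((m : J → C), m) (by simp)
    exact h1.symm.trans h2

section
variable {A : Type} [Ring A] {C : Type} [AddCommGroup C] [Module A C]

theorem memADD_retract {Y Z : ModuleCat.{0} A} (s : Y →ₗ[A] Z) (r : Z →ₗ[A] Y)
    (h : r ∘ₗ s = LinearMap.id) (hZ : memADD A C Z) : memADD A C Y := by
  obtain ⟨ι, s', r', h'⟩ := hZ
  refine ⟨ι, s' ∘ₗ s, r ∘ₗ r', ?_⟩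
  ext x
  have h1 := LinearMap.congr_fun h' (s x)
  have h2 := LinearMap.congr_fun h x
  simp only [LinearMap.comp_apply, LinearMap.id_apply] at h1 h2 ⊢
  rw [h1, h2]

theorem cocycVan_memADD {X : ModuleCat.{0} A} (P : ProjectiveResolution X)
    (hpc : ProductComplete A C) (hC : cocycVan P (ModuleCat.of A C)) (Y : ModuleCat.{0} A)
    (hY : memADD A C Y) : cocycVan P Y := by
  obtain ⟨J, s, r, h⟩ := hY
  obtain ⟨q, hq⟩ := sum_split hpc J
  refine cocycVan_retract P (Z := ModuleCat.of A (J →₀ C)) s r h ?_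
  let incl : (J →₀ C) →ₗ[A] (J → C) := LinearMap.pi fun j => Finsupp.lapply (R := A) j
  refine cocycVan_retract P (Z := ModuleCat.of A (J → C)) incl q ?_ (cocycVan_pi P C J hC)
  exact LinearMap.ext fun m => hq m

/-- The kernels in a sequence of modules. -/
abbrev kerObj (D : ℕ → ModuleCat.{0} A) (d : ∀ i, D i ⟶ D (i + 1)) (i : ℕ) : ModuleCat.{0} A :=
  ModuleCat.of A (LinearMap.ker (d i).hom)

/-- Inclusion of the kernel. -/
abbrev kerIncl (D : ℕ → ModuleCat.{0} A) (d : ∀ i, D i ⟶ D (i + 1)) (i : ℕ) :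
    kerObj D d i ⟶ D i :=
  ModuleCat.ofHom (LinearMap.ker (d i).hom).subtype

theorem kerIncl_inj (D : ℕ → ModuleCat.{0} A) (d : ∀ i, D i ⟶ D (i + 1)) (i : ℕ) :
    Function.Injective (kerIncl D d i) :=
  Subtype.val_injective

theorem kerIncl_exact (D : ℕ → ModuleCat.{0} A) (d : ∀ i, D i ⟶ D (i + 1)) (i : ℕ) :
    Function.Exact (kerIncl D d i) (d i) := by
  intro x
  constructor
  · intro hx
    exact ⟨⟨x, hx⟩, rfl⟩
  · rintro ⟨y, rfl⟩
    exact y.2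

theorem exists_kerProj (D : ℕ → ModuleCat.{0} A) (d : ∀ i, D i ⟶ D (i + 1)) (i : ℕ)
    (hex : Function.Exact (d i) (d (i + 1))) :
    ∃ b : D i ⟶ kerObj D d (i + 1), Function.Surjective b ∧ Function.Exact (kerIncl D d i) b ∧
      ∀ x, ((b x).1 : D (i + 1)) = d i x := by
  refine ⟨ModuleCat.ofHom ((d i).hom.codRestrict _ fun x => hex.apply_apply_eq_zero x), ?_, ?_, ?_⟩
  · rintro ⟨y, hy⟩
    obtain ⟨x, hx⟩ := (hex y).1 hy
    exact ⟨x, Subtype.ext hx⟩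
  · intro x
    rw [← kerIncl_exact D d i x]
    exact Subtype.ext_iff
  · intro x; rfl

theorem kerVan {X : ModuleCat.{0} A} (P : ProjectiveResolution X)
    (D : ℕ → ModuleCat.{0} A) (d : ∀ i, D i ⟶ D (i + 1)) (n : ℕ)
    (h0 : Function.Injective (d 0)) (hex : ∀ i < n, Function.Exact (d i) (d (i + 1)))
    (hD : ∀ i < n, cocycVan P (D i)) : ∀ i ≤ n, cocycVan P (kerObj D d i) := by
  intro i
  induction i with
  | zero =>
    intro _
    have : Subsingleton (kerObj D d 0) := by
      refine ⟨fun x y => Subtype.ext (h0 ?_)⟩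
      exact (x.2 : (d 0).hom x.1 = 0).trans (y.2 : (d 0).hom y.1 = 0).symm
    exact cocycVan_of_subsingleton P _
  | succ i ih =>
    intro hi
    obtain ⟨b, hb1, hb2, _⟩ := exists_kerProj D d i (hex i hi)
    exact cocycVan_shift P _ b (kerIncl_inj D d i) hb1 hb2 (ih (by omega)) (hD i hi)

/-- A kernel of a map onto a module in `Add(C)` splits. -/
theorem ker_split (P : ProjectiveResolution (ModuleCat.of A C))
    {K B D : ModuleCat.{0} A} (a : K ⟶ B) (b : B ⟶ D) (ha : Function.Injective a)
    (hb : Function.Surjective b) (hab : Function.Exact a b)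
    (hK : cocycVan P K) (hB : memADD A C B) (hD : memADD A C D) : memADD A C K := by
  obtain ⟨J, s, r, h⟩ := hD
  have hl : ∀ j : J, ∃ u : ModuleCat.of A C ⟶ B,
      u ≫ b = ModuleCat.ofHom (r ∘ₗ Finsupp.lsingle (R := A) j) := fun j =>
    cocycVan_lift P a b ha hb hab hK _
  choose u hu using hl
  let v : (J →₀ C) →ₗ[A] B := Finsupp.lsum ℕ fun j => (u j).hom
  have hv : b.hom ∘ₗ v = r := by
    refine Finsupp.lhom_ext' fun j => LinearMap.ext fun c => ?_
    have := ConcreteCategory.congr_hom (hu j) c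
    simpa [v] using this
  have hsec : b.hom ∘ₗ (v ∘ₗ s) = LinearMap.id := by
    rw [← LinearMap.comp_assoc, hv, h]
  have hker : ∀ x : B, ∃ y : K, a.hom y = x - v (s (b.hom x)) := by
    intro x
    apply (hab _).1
    have := LinearMap.congr_fun hsec (b.hom x)
    change b.hom _ = 0
    rw [map_sub, sub_eq_zero]
    exact this.symm
  choose ρ hρ using hker
  have ha' : Function.Injective a.hom := ha
  refine memADD_retract a.hom (Z := B) { toFun := ρ, map_add' := ?_, map_smul' := ?_ } ?_ hB
  · intro x y
    apply ha'
    rw [map_add, hρ, hρ, hρ]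
    simp only [map_add]; abel
  · intro t x
    apply ha'
    rw [RingHom.id_apply, map_smul, hρ, hρ]
    simp only [map_smul, smul_sub]
  · ext y
    apply ha'
    change a.hom (ρ (a.hom y)) = a.hom y
    have h0 : b.hom (a.hom y) = 0 := hab.apply_apply_eq_zero y
    rw [hρ, h0]
    simp

end

theorem stmt5 (R : Type) [Ring R] (C : Type) [AddCommGroup C] [Module Rᵐᵒᵖ C] (n : ℕ)
    (hpc : ProductComplete Rᵐᵒᵖ C)
    (hso : ∀ i, 1 ≤ i →
      Subsingleton (extM Rᵐᵒᵖ i (ModuleCat.of Rᵐᵒᵖ C) (ModuleCat.of Rᵐᵒᵖ C))) :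
    (∀ (D : ℕ → ModuleCat.{0} Rᵐᵒᵖ) (d : ∀ i, D i ⟶ D (i + 1)),
      Function.Injective (d 0) → Function.Surjective (d n) →
      (∀ i < n, Function.Exact (d i) (d (i + 1))) →
      (∀ i ≤ n, memADD Rᵐᵒᵖ C (D (i + 1))) →
      (∀ i, 1 ≤ i → Subsingleton (extM Rᵐᵒᵖ i (ModuleCat.of Rᵐᵒᵖ C) (D 0))) →
      memADD Rᵐᵒᵖ C (D 0)) ∧
    (∀ (D : ℕ → ModuleCat.{0} Rᵐᵒᵖ) (d : ∀ i, D i ⟶ D (i + 1)),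
      Function.Injective (d 0) → Function.Surjective (d n) →
      (∀ i < n, Function.Exact (d i) (d (i + 1))) →
      (∀ i ≤ n, memADD Rᵐᵒᵖ C (D i)) →
      (∀ i, 1 ≤ i → Subsingleton (extM Rᵐᵒᵖ i (D (n + 1)) (ModuleCat.of Rᵐᵒᵖ C))) →
      memADD Rᵐᵒᵖ C (D (n + 1))) := by
  constructor
  · intro D d h0 hn hex hAdd hExt
    obtain ⟨P⟩ := (inferInstance : HasProjectiveResolution (ModuleCat.of Rᵐᵒᵖ C)).out
    have hC := cocycVan_of_ext P _ hso
    have hvan := kerVan P D d n h0 hex (by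
      intro i hi
      cases i with
      | zero => exact cocycVan_of_ext P _ hExt
      | succ i => exact cocycVan_memADD P hpc hC _ (hAdd i (by omega)))
    -- all kernels in positive degree lie in `Add(C)`
    have hker : ∀ k i, i + k = n → 1 ≤ i → memADD Rᵐᵒᵖ C (kerObj D d i) := by
      intro k
      induction k with
      | zero =>
        intro i hi h1
        obtain rfl : i = n := by omega
        obtain ⟨m, rfl⟩ : ∃ m, i = m + 1 := ⟨i - 1, by omega⟩
        exact ker_split P _ (d (m + 1)) (kerIncl_inj D d _) hn (kerIncl_exact D d _)
          (hvan _ le_rfl) (hAdd m (by omega)) (hAdd (m + 1) le_rfl)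
      | succ k ih =>
        intro i hi h1
        obtain ⟨b, hb1, hb2, _⟩ := exists_kerProj D d i (hex i (by omega))
        obtain ⟨m, rfl⟩ : ∃ m, i = m + 1 := ⟨i - 1, by omega⟩
        exact ker_split P _ b (kerIncl_inj D d _) hb1 hb2
          (hvan _ (by omega)) (hAdd m (by omega)) (ih _ (by omega) (by omega))
    cases n with
    | zero =>
      let e := LinearEquiv.ofBijective (d 0).hom ⟨h0, hn⟩
      exact memADD_retract e.toLinearMap e.symm.toLinearMap (by ext x; simp) (hAdd 0 le_rfl)
    | succ n =>
      obtain ⟨b, hb1, _, hb3⟩ := exists_kerProj D d 0 (hex 0 (by omega))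
      let e := LinearEquiv.ofBijective b.hom ⟨fun x y hxy => h0 (by
        rw [← hb3, ← hb3]; exact congrArg Subtype.val hxy), hb1⟩
      exact memADD_retract (Z := kerObj D d 1) e.toLinearMap e.symm.toLinearMap
        (by ext x; simp) (hker n 1 (by omega) le_rfl)
  · intro D d h0 hn hex hAdd hExt
    obtain ⟨P⟩ := (inferInstance : HasProjectiveResolution (D (n + 1))).out
    have hC := cocycVan_of_ext P _ hExt
    have hvan := kerVan P D d n h0 hex (fun i hi => cocycVan_memADD P hpc hC _ (hAdd i hi.le))
    obtain ⟨s, hs⟩ := cocycVan_lift P _ (d n) (kerIncl_inj D d n) hn (kerIncl_exact D d n)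
      (hvan n le_rfl) (𝟙 _)
    refine memADD_retract s.hom (d n).hom ?_ (hAdd n le_rfl)
    rw [← ModuleCat.hom_comp, hs]; rfl
end

section
/- Let F be a flat right S-module and C an (S,R)-bimodule that is self-orthogonal as a right R-module with Ext^i_R(C, C) = 0 for all i ≥ 1. Then for every index set J, Ext^i_R(C^{(J)}, F ⊗_S C) ≅ (F ⊗_S Ext^i_R(C, C))^J = 0 for all i ≥ 1, provided C_R is finitely generated over a right Noetherian ring R. Moreover, id((F ⊗_S C)_R) ≤ id(C_R). -/
/-!
STATEMENT 17: Let R be right Noetherian (right R-modules are modeled as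
`Rᵐᵒᵖ`-modules), C an (S,R)-bimodule finitely generated over R, and F a flat
right S-module.  Then for every index set J and all i ≥ 1,
  Ext^i_R(C^{(J)}, F ⊗_S C) ≅ (F ⊗_S Ext^i_R(C, C))^J = 0
(with C self-orthogonal the middle term is zero, so the content is the vanishing
of Ext^i_R(C^{(J)}, F ⊗_S C)); moreover id((F ⊗_S C)_R) ≤ id(C_R).

Since Mathlib's tensor product requires a commutative base ring, the tensor
product `F ⊗_S C` over the noncommutative ring S is realized as the quotient of
`C ⊗[ℤ] F` by the Rᵐᵒᵖ-submodule generated by the relations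
`(s • c) ⊗ x - c ⊗ (x • s)`; flatness of the right S-module F is expressed by
the standard characterization: the character module `F⁺ = Hom_ℤ(F, ℚ/ℤ)` is an
injective left S-module.
-/

open CategoryTheory Opposite

/-- The injective dimension of `X` is `≤ n`. -/
def injDimLE (A : Type) [Ring A] (X : ModuleCat.{0} A) (n : ℕ) : Prop :=
  ∀ (Y : ModuleCat.{0} A) (i : ℕ), n < i → Subsingleton (extM A i Y X)

section CharacterModule

variable (S : Type) [Ring S] (F : Type) [AddCommGroup F] [Module Sᵐᵒᵖ F]

/-- The character module `F⁺ = Hom_ℤ(F, ℚ/ℤ)` of `F`. -/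
def CharMod : Type := F →+ AddCircle (1 : ℚ)

instance : AddCommGroup (CharMod F) :=
  inferInstanceAs (AddCommGroup (F →+ AddCircle (1 : ℚ)))

instance : FunLike (CharMod F) F (AddCircle (1 : ℚ)) :=
  inferInstanceAs (FunLike (F →+ AddCircle (1 : ℚ)) F (AddCircle (1 : ℚ)))

instance : AddMonoidHomClass (CharMod F) F (AddCircle (1 : ℚ)) :=
  inferInstanceAs (AddMonoidHomClass (F →+ AddCircle (1 : ℚ)) F (AddCircle (1 : ℚ)))

/-- For a right S-module `F`, the character module `F⁺` is a left S-module via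
`(s • φ) x = φ (x • s)`. -/
instance : SMul S (CharMod F) :=
  ⟨fun s φ => (φ : F →+ AddCircle (1 : ℚ)).comp
    (DistribSMul.toAddMonoidHom F (MulOpposite.op s))⟩

lemma charMod_smul_apply (s : S) (φ : CharMod F) (x : F) :
    (s • φ) x = φ (MulOpposite.op s • x) :=
  rfl

instance : Module S (CharMod F) where
  one_smul φ := DFunLike.ext _ _ fun x => by
    rw [charMod_smul_apply, MulOpposite.op_one, one_smul]
  mul_smul s t φ := DFunLike.ext _ _ fun x => by
    rw [charMod_smul_apply, charMod_smul_apply, charMod_smul_apply,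
      MulOpposite.op_mul, mul_smul]
  smul_zero s := DFunLike.ext _ _ fun x => rfl
  smul_add s φ ψ := DFunLike.ext _ _ fun x => rfl
  add_smul s t φ := DFunLike.ext _ _ fun x => by
    show (((s + t) • φ)) x = (s • φ) x + (t • φ) x
    rw [charMod_smul_apply, charMod_smul_apply, charMod_smul_apply,
      MulOpposite.op_add, add_smul, map_add]
  zero_smul φ := DFunLike.ext _ _ fun x => by
    show ((0 : S) • φ) x = (0 : CharMod F) x
    rw [charMod_smul_apply, MulOpposite.op_zero, zero_smul, map_zero]; rfl

/-- A right S-module `F` is flat iff its character module is an injective left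
S-module. -/
def FlatRight : Prop := Module.Injective S (CharMod F)

end CharacterModule

section Tensor

variable (R : Type) [Ring R] (S : Type) [Ring S]
variable (C : Type) [AddCommGroup C] [Module Rᵐᵒᵖ C] [Module S C] [SMulCommClass S Rᵐᵒᵖ C]
variable (F : Type) [AddCommGroup F] [Module Sᵐᵒᵖ F]

/-- The submodule of relations defining `F ⊗_S C` inside `C ⊗[ℤ] F`. -/
def tensRel : Submodule Rᵐᵒᵖ (TensorProduct ℤ C F) :=
  Submodule.span Rᵐᵒᵖ
    {t | ∃ (s : S) (c : C) (x : F),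
      t = (s • c) ⊗ₜ[ℤ] x - c ⊗ₜ[ℤ] (MulOpposite.op s • x)}

/-- The tensor product `F ⊗_S C` of a right S-module and an (S,R)-bimodule, as a
right R-module. -/
def tensNC : Type := TensorProduct ℤ C F ⧸ tensRel R S C F

noncomputable instance : AddCommGroup (tensNC R S C F) :=
  inferInstanceAs (AddCommGroup (TensorProduct ℤ C F ⧸ tensRel R S C F))

noncomputable instance : Module Rᵐᵒᵖ (tensNC R S C F) :=
  inferInstanceAs (Module Rᵐᵒᵖ (TensorProduct ℤ C F ⧸ tensRel R S C F))

end Tensor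


open Limits

lemma extM_iff {A : Type} [Ring A] (X Y : ModuleCat.{0} A) (n : ℕ)
    (P : ProjectiveResolution X) :
    Subsingleton (extM A (n+1) X Y) ↔
      ∀ f : P.complex.X (n+1) ⟶ Y, P.complex.d (n+2) (n+1) ≫ f = 0 →
        ∃ g : P.complex.X n ⟶ Y, P.complex.d (n+1) n ≫ g = f := by
  rw [← ModuleCat.isZero_iff_subsingleton]
  have e := P.isoExt (R := ℤ) (n+1) Y
  unfold extM
  rw [e.isZero_iff, ← HomologicalComplex.exactAt_iff_isZero_homology,
    HomologicalComplex.exactAt_iff' _ n (n+1) (n+2) (by simp) (by simp),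
    ShortComplex.moduleCat_exact_iff]
  rfl

lemma absExt_iff {A : Type} [Ring A] (X Y : ModuleCat.{0} A) (n : ℕ)
    (P : ProjectiveResolution X) :
    Subsingleton (Abelian.Ext X Y (n+1)) ↔
      ∀ f : P.complex.X (n+1) ⟶ Y, P.complex.d (n+2) (n+1) ≫ f = 0 →
        ∃ g : P.complex.X n ⟶ Y, P.complex.d (n+1) n ≫ g = f := by
  constructor
  · intro h f hf
    exact (P.extMk_eq_zero_iff f (n+2) rfl hf n rfl).1 (Subsingleton.elim _ _)
  · intro h
    refine subsingleton_of_forall_eq 0 fun e => ?_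
    obtain ⟨f, hf, rfl⟩ := P.extMk_surjective e (n+2) rfl
    exact (P.extMk_eq_zero_iff f (n+2) rfl hf n rfl).2 (h f hf)

lemma extM_iff_abs {A : Type} [Ring A] (X Y : ModuleCat.{0} A) (n : ℕ) :
    Subsingleton (extM A (n+1) X Y) ↔ Subsingleton (Abelian.Ext X Y (n+1)) :=
  (extM_iff X Y n (projectiveResolution X)).trans
    (absExt_iff X Y n (projectiveResolution X)).symm

open Abelian in
lemma ext_shift_left {A : Type} [Ring A] {S : ShortComplex (ModuleCat.{0} A)}
    (hS : S.ShortExact) [Projective S.X₂] (Y : ModuleCat.{0} A) (n : ℕ) :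
    Subsingleton (Ext S.X₃ Y (n+2)) ↔ Subsingleton (Ext S.X₁ Y (n+1)) := by
  constructor
  · intro h
    refine subsingleton_of_forall_eq 0 fun e => ?_
    obtain ⟨x, rfl⟩ := Ext.contravariant_sequence_exact₁ hS Y e (n₁ := n+2) (by omega)
      (Subsingleton.elim _ _)
    rw [Ext.eq_zero_of_projective x, Ext.comp_zero]
  · intro h
    refine subsingleton_of_forall_eq 0 fun e => ?_
    obtain ⟨x, rfl⟩ := Ext.contravariant_sequence_exact₃ hS Y e (n₀ := n+1)
      (Ext.eq_zero_of_projective _) (by omega)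
    rw [Subsingleton.elim x 0, Ext.comp_zero]

open Abelian in
lemma ext_shift_right {A : Type} [Ring A] {S : ShortComplex (ModuleCat.{0} A)}
    (hS : S.ShortExact) [Injective S.X₂] (X : ModuleCat.{0} A) (n : ℕ) :
    Subsingleton (Ext X S.X₁ (n+2)) ↔ Subsingleton (Ext X S.X₃ (n+1)) := by
  constructor
  · intro h
    refine subsingleton_of_forall_eq 0 fun e => ?_
    obtain ⟨x, rfl⟩ := Ext.covariant_sequence_exact₃ X hS e (n₁ := n+2) (by omega)
      (Subsingleton.elim _ _)
    rw [Ext.eq_zero_of_injective x, Ext.zero_comp]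
  · intro h
    refine subsingleton_of_forall_eq 0 fun e => ?_
    obtain ⟨x, rfl⟩ := Ext.covariant_sequence_exact₁ X hS e (n₀ := n+1)
      (Ext.eq_zero_of_injective _) (by omega)
    rw [Subsingleton.elim x 0, Ext.zero_comp]

open Abelian in
lemma ext_one_left {A : Type} [Ring A] {S : ShortComplex (ModuleCat.{0} A)}
    (hS : S.ShortExact) [Projective S.X₂] (Y : ModuleCat.{0} A) :
    Subsingleton (Ext S.X₃ Y 1) ↔ ∀ f : S.X₁ ⟶ Y, ∃ g : S.X₂ ⟶ Y, S.f ≫ g = f := by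
  constructor
  · intro h f
    obtain ⟨x, hx⟩ := Ext.contravariant_sequence_exact₁ hS Y (Ext.mk₀ f) (n₁ := 1) (by omega)
      (Subsingleton.elim _ _)
    obtain ⟨g, rfl⟩ := (Ext.mk₀_bijective _ _).2 x
    refine ⟨g, (Ext.mk₀_bijective _ _).1 ?_⟩
    rw [← hx, Ext.mk₀_comp_mk₀]
  · intro h
    refine subsingleton_of_forall_eq 0 fun e => ?_
    obtain ⟨x, rfl⟩ := Ext.contravariant_sequence_exact₃ hS Y e (n₀ := 0)
      (Ext.eq_zero_of_projective _) (by omega)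
    obtain ⟨f, rfl⟩ := (Ext.mk₀_bijective _ _).2 x
    obtain ⟨g, rfl⟩ := h f
    rw [← Ext.mk₀_comp_mk₀, ← Ext.comp_assoc_of_second_deg_zero, hS.extClass_comp, Ext.zero_comp]

open Abelian in
lemma ext_one_right {A : Type} [Ring A] {S : ShortComplex (ModuleCat.{0} A)}
    (hS : S.ShortExact) [Injective S.X₂] (X : ModuleCat.{0} A) :
    Subsingleton (Ext X S.X₁ 1) ↔ ∀ f : X ⟶ S.X₃, ∃ g : X ⟶ S.X₂, g ≫ S.g = f := by
  constructor
  · intro h f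
    obtain ⟨x, hx⟩ := Ext.covariant_sequence_exact₃ X hS (Ext.mk₀ f) (n₁ := 1) (by omega)
      (Subsingleton.elim _ _)
    obtain ⟨g, rfl⟩ := (Ext.mk₀_bijective _ _).2 x
    refine ⟨g, (Ext.mk₀_bijective _ _).1 ?_⟩
    rw [← hx, Ext.mk₀_comp_mk₀]
  · intro h
    refine subsingleton_of_forall_eq 0 fun e => ?_
    obtain ⟨x, rfl⟩ := Ext.covariant_sequence_exact₁ X hS e (n₀ := 0)
      (Ext.eq_zero_of_injective _) (by omega)
    obtain ⟨f, rfl⟩ := (Ext.mk₀_bijective _ _).2 x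
    obtain ⟨g, rfl⟩ := h f
    rw [← Ext.mk₀_comp_mk₀, Ext.comp_assoc_of_second_deg_zero, hS.comp_extClass, Ext.comp_zero]

lemma exists_inj {A : Type} [Ring A] (Y : ModuleCat.{0} A) :
    ∃ S : ShortComplex (ModuleCat.{0} A), S.ShortExact ∧ Injective S.X₂ ∧ S.X₁ = Y := by
  obtain ⟨p⟩ := EnoughInjectives.presentation Y
  have := p.injective
  have := p.mono
  exact ⟨ShortComplex.mk p.f (cokernel.π p.f) (cokernel.condition _),
    { exact := ShortComplex.exact_cokernel p.f, mono_f := p.mono }, p.injective, rfl⟩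

lemma ext_finsupp {A : Type} [Ring A] (X : Type) [AddCommGroup X] [Module A X] (J : Type)
    (n : ℕ) (Y : ModuleCat.{0} A)
    (h : Subsingleton (Abelian.Ext (ModuleCat.of A X) Y (n+1))) :
    Subsingleton (Abelian.Ext (ModuleCat.of A (J →₀ X)) Y (n+1)) := by
  induction n generalizing Y with
  | zero =>
    obtain ⟨S, hS, hI, rfl⟩ := exists_inj Y
    rw [zero_add, ext_one_right hS] at h ⊢
    intro f
    choose g hg using fun j : J => h (ModuleCat.ofHom (f.hom ∘ₗ Finsupp.lsingle j))
    refine ⟨ModuleCat.ofHom (Finsupp.lsum ℕ fun j => (g j).hom), ?_⟩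
    ext : 1
    refine Finsupp.lhom_ext' fun j => ?_
    have := congrArg ModuleCat.Hom.hom (hg j)
    rw [ModuleCat.hom_ofHom] at this
    rw [← this]
    ext x
    simp
  | succ n ih =>
    obtain ⟨S, hS, hI, rfl⟩ := exists_inj Y
    rw [ext_shift_right hS] at h ⊢
    exact ih _ h

lemma ext_one_ker {A : Type} [Ring A] {P M : Type} [AddCommGroup P] [Module A P]
    [AddCommGroup M] [Module A M] [Module.Projective A P]
    (p : P →ₗ[A] M) (hp : Function.Surjective p) (Y : Type) [AddCommGroup Y] [Module A Y] :
    Subsingleton (Abelian.Ext (ModuleCat.of A M) (ModuleCat.of A Y) 1) ↔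
      ∀ f : LinearMap.ker p →ₗ[A] Y, ∃ g : P →ₗ[A] Y, ∀ x : LinearMap.ker p, g x = f x := by
  have hS := LinearMap.shortExact_shortComplexKer hp
  have : Projective p.shortComplexKer.X₂ :=
    inferInstanceAs (Projective (ModuleCat.of A P))
  refine (ext_one_left hS (ModuleCat.of A Y)).trans ⟨fun h f => ?_, fun h f => ?_⟩
  · obtain ⟨g, hg⟩ := h (ModuleCat.ofHom f)
    exact ⟨g.hom, fun x => congrArg (fun t => t.hom x) hg⟩
  · obtain ⟨g, hg⟩ := h f.hom
    refine ⟨ModuleCat.ofHom g, ?_⟩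
    ext x
    exact hg x

lemma injDim_of_ideals {A : Type} [Ring A] (n : ℕ) (Y : ModuleCat.{0} A)
    (h : ∀ I : Submodule A A, Subsingleton (Abelian.Ext (ModuleCat.of A (A ⧸ I)) Y (n+1))) :
    HasInjectiveDimensionLE Y n := by
  induction n generalizing Y with
  | zero =>
    have : Module.Baer A Y := by
      intro I g
      have h2 := (ext_one_ker I.mkQ I.mkQ_surjective Y).1 (h I)
      obtain ⟨g', hg'⟩ := h2 (g ∘ₗ (LinearEquiv.ofEq _ _ I.ker_mkQ).toLinearMap)
      exact ⟨g', fun x hx => hg' ⟨x, by simpa using hx⟩⟩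
    have h3 := this.injective
    rw [Module.injective_iff_injective_object] at h3
    exact injective_iff_hasInjectiveDimensionLT_one.1 h3
  | succ n ih =>
    obtain ⟨S, hS, hI, rfl⟩ := exists_inj Y
    exact (hS.hasInjectiveDimensionLT_X₃_iff n hI).1
      (ih _ fun I => (ext_shift_right hS _ _).1 (h I))
set_option linter.unusedSectionVars false

/-- Exactness in the middle of `Y^k → Y^m → Y^l`, the maps being given by matrices. -/
def MatExact {A : Type} [Ring A] {k m l : ℕ} (a : Fin m → Fin k → A) (b : Fin l → Fin m → A)
    (Y : Type) [AddCommGroup Y] [Module A Y] : Prop :=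
  ∀ y : Fin m → Y, (∀ p, ∑ j, b p j • y j = 0) → ∃ z : Fin k → Y, ∀ j, y j = ∑ i, a j i • z i

lemma exists_matrices {A : Type} [Ring A] [IsNoetherianRing A] {k : ℕ} {M : Type}
    [AddCommGroup M] [Module A M] (p : (Fin k → A) →ₗ[A] M) :
    ∃ (m l : ℕ) (a : Fin m → Fin k → A) (b : Fin l → Fin m → A),
      ∀ (Y : Type) [AddCommGroup Y] [Module A Y],
        (∀ f : LinearMap.ker p →ₗ[A] Y, ∃ g : (Fin k → A) →ₗ[A] Y,
          ∀ x : LinearMap.ker p, g x = f x) ↔ MatExact a b Y := by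
  obtain ⟨m, q, hq⟩ := Module.Finite.exists_fin' A (LinearMap.ker p)
  obtain ⟨l, r, hr⟩ := Module.Finite.exists_fin' A (LinearMap.ker q)
  refine ⟨m, l, fun j => (q (Pi.single j 1) : Fin k → A),
    fun s => (r (Pi.single s 1) : Fin m → A), fun Y _ _ => ⟨fun h y hy => ?_, fun h f => ?_⟩⟩
  · let ft : (Fin m → A) →ₗ[A] Y := Fintype.linearCombination A y
    have hft : ∀ x, ft x = ∑ j, x j • y j := fun x => Fintype.linearCombination_apply A y x
    have hk : LinearMap.ker q ≤ LinearMap.ker ft := by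
      intro x hx
      obtain ⟨w, hw⟩ := hr ⟨x, hx⟩
      have h0 : ft ∘ₗ (LinearMap.ker q).subtype ∘ₗ r = 0 := by
        refine LinearMap.pi_ext' fun s => LinearMap.ext_ring ?_
        simpa [hft] using hy s
      have := LinearMap.congr_fun h0 w
      simp only [LinearMap.comp_apply, hw] at this
      exact this
    let f : LinearMap.ker p →ₗ[A] Y :=
      (LinearMap.ker q).liftQ ft hk ∘ₗ (q.quotKerEquivOfSurjective hq).symm.toLinearMap
    have hf : ∀ x, f (q x) = ft x := by
      intro x
      have : (q.quotKerEquivOfSurjective hq).symm (q x) = (LinearMap.ker q).mkQ x := by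
        rw [LinearEquiv.symm_apply_eq]; rfl
      simp only [f, LinearMap.comp_apply, LinearEquiv.coe_coe, this]
      rfl
    obtain ⟨g, hg⟩ := h f
    refine ⟨fun i => g (Pi.single i 1), fun j => ?_⟩
    have h1 := hg (q (Pi.single j 1))
    rw [hf, hft, LinearMap.pi_apply_eq_sum_univ g] at h1
    rw [Finset.sum_eq_single j (by intro b _ hb; simp [hb]) (by simp)] at h1
    simp only [Pi.single_eq_same, one_smul] at h1
    rw [← h1]
    refine Finset.sum_congr rfl fun i _ => ?_
    congr 2
    ext t
    simp [Pi.single_apply, eq_comm]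
  · obtain ⟨z, hz⟩ := h (fun j => f (q (Pi.single j 1))) (by
      intro s
      have h1 : (f ∘ₗ q) (r (Pi.single s 1) : Fin m → A) = 0 := by
        rw [LinearMap.comp_apply, (r (Pi.single s 1)).2, map_zero]
      rw [LinearMap.pi_apply_eq_sum_univ (f ∘ₗ q)] at h1
      rw [← h1]
      refine Finset.sum_congr rfl fun i _ => ?_
      simp only [LinearMap.comp_apply]
      congr 3
      ext t
      simp [Pi.single_apply, eq_comm])
    refine ⟨Fintype.linearCombination A z, fun x => ?_⟩
    obtain ⟨w, rfl⟩ := hq x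
    have : Fintype.linearCombination A z ∘ₗ (LinearMap.ker p).subtype ∘ₗ q = f ∘ₗ q := by
      refine LinearMap.pi_ext' fun s => LinearMap.ext_ring ?_
      simp only [LinearMap.comp_apply, LinearMap.single_apply]
      rw [hz s]
      exact Fintype.linearCombination_apply A z _
    exact LinearMap.congr_fun this w

section
variable (R : Type) [Ring R] (S : Type) [Ring S]
variable (C : Type) [AddCommGroup C] [Module Rᵐᵒᵖ C] [Module S C] [SMulCommClass S Rᵐᵒᵖ C]
variable (F : Type) [AddCommGroup F] [Module Sᵐᵒᵖ F]

/-- The pure tensor. -/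
noncomputable def tmk (c : C) (x : F) : tensNC R S C F :=
  (tensRel R S C F).mkQ (c ⊗ₜ[ℤ] x)

variable {R S C F}

lemma tmk_add_left (c c' : C) (x : F) :
    tmk R S C F (c + c') x = tmk R S C F c x + tmk R S C F c' x := by
  unfold tmk; rw [TensorProduct.add_tmul]; exact map_add _ _ _

lemma tmk_add_right (c : C) (x x' : F) :
    tmk R S C F c (x + x') = tmk R S C F c x + tmk R S C F c x' := by
  unfold tmk; rw [TensorProduct.tmul_add]; exact map_add _ _ _

lemma tmk_smul (r : Rᵐᵒᵖ) (c : C) (x : F) :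
    tmk R S C F (r • c) x = r • tmk R S C F c x := by
  unfold tmk; rw [← TensorProduct.smul_tmul']; exact map_smul _ _ _

lemma tmk_zero_left (x : F) : tmk R S C F 0 x = 0 := by
  unfold tmk; rw [TensorProduct.zero_tmul]; exact map_zero _

lemma tmk_sum {ι : Type} (s : Finset ι) (c : ι → C) (x : F) :
    tmk R S C F (∑ i ∈ s, c i) x = ∑ i ∈ s, tmk R S C F (c i) x :=
  map_sum (AddMonoidHom.mk' (fun c => tmk R S C F c x) fun c c' => tmk_add_left c c' x) c s

lemma tmk_balanced (s : S) (c : C) (x : F) :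
    tmk R S C F (s • c) x = tmk R S C F c (MulOpposite.op s • x) := by
  refine (Submodule.Quotient.eq _).2 (Submodule.subset_span ⟨s, c, x, rfl⟩)

/-- Two additive maps that agree on pure tensors are equal. -/
lemma tensNC_hom_ext {B : Type} [AddCommGroup B] (f g : tensNC R S C F →+ B)
    (h : ∀ c x, f (tmk R S C F c x) = g (tmk R S C F c x)) : f = g := by
  ext t
  obtain ⟨t, rfl⟩ := (tensRel R S C F).mkQ_surjective t
  induction t with
  | zero => exact ((map_zero f).trans (map_zero g).symm)
  | tmul c x => exact h c x
  | add t u ht hu =>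
    rw [map_add]
    exact (map_add f _ _).trans ((congrArg₂ _ ht hu).trans (map_add g _ _).symm)

/-- An `S`-linear map `C → F⁺` gives a character of `F ⊗_S C`. -/
lemma exists_char (ψ : C →ₗ[S] CharMod F) :
    ∃ χ : tensNC R S C F →+ AddCircle (1 : ℚ), ∀ c x, χ (tmk R S C F c x) = ψ c x := by
  let ψ' : C →+ F →+ AddCircle (1 : ℚ) := ψ.toAddMonoidHom
  let f : TensorProduct ℤ C F →+ AddCircle (1 : ℚ) :=
    TensorProduct.liftAddHom ψ' (fun r c x => by simp)
  have hf : ∀ c x, f (c ⊗ₜ x) = ψ c x := fun c x => rfl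
  have hk : ∀ t ∈ tensRel R S C F, ∀ r : Rᵐᵒᵖ, f (r • t) = 0 := by
    intro t ht
    induction ht using Submodule.span_induction with
    | mem t ht =>
      obtain ⟨s, c, x, rfl⟩ := ht
      intro r
      rw [smul_sub, TensorProduct.smul_tmul', TensorProduct.smul_tmul', map_sub, hf, hf,
        ← smul_comm s r c, map_smul, charMod_smul_apply, sub_self]
    | zero => intro r; simp
    | add t u _ _ ht hu => intro r; rw [smul_add, map_add, ht, hu, add_zero]
    | smul r' t _ ht => intro r; rw [smul_smul]; exact ht _
  refine ⟨QuotientAddGroup.lift (tensRel R S C F).toAddSubgroup f fun t ht => ?_, hf⟩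
  have := hk t ht 1
  rwa [one_smul] at this

lemma matExact_tens (hF : FlatRight S F) {k m l : ℕ} (a : Fin m → Fin k → Rᵐᵒᵖ)
    (b : Fin l → Fin m → Rᵐᵒᵖ) (h : MatExact a b C) : MatExact a b (tensNC R S C F) := by
  intro y hy
  by_contra hcon
  let α : (Fin k → tensNC R S C F) →+ (Fin m → tensNC R S C F) :=
    AddMonoidHom.mk' (fun z j => ∑ i, a j i • z i) (by
      intro z z'; ext j; simp [smul_add, Finset.sum_add_distrib])
  have hy' : y ∉ α.range := by
    rintro ⟨z, hz⟩
    exact hcon ⟨z, fun j => (congrFun hz j).symm⟩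
  obtain ⟨c0, hc0⟩ := CharacterModule.exists_character_apply_ne_zero_of_ne_zero
    (a := (QuotientAddGroup.mk y : (Fin m → tensNC R S C F) ⧸ α.range))
    (by rwa [Ne, QuotientAddGroup.eq_zero_iff])
  let χ : (Fin m → tensNC R S C F) →+ AddCircle (1 : ℚ) :=
    AddMonoidHom.comp c0 (QuotientAddGroup.mk' α.range)
  have hχα : ∀ z, χ (α z) = 0 := by
    intro z
    have : (QuotientAddGroup.mk' α.range) (α z) = 0 :=
      (QuotientAddGroup.eq_zero_iff _).2 ⟨z, rfl⟩
    exact (congrArg c0 this).trans (map_zero c0)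
  have hχy : χ y ≠ 0 := hc0
  let φ : (Fin m → C) →ₗ[S] CharMod F :=
    { toFun := fun c => (AddMonoidHom.mk' (fun x => χ (fun j => tmk R S C F (c j) x)) (by
        intro x x'
        rw [← map_add]; congr 1; ext j; exact tmk_add_right _ _ _) : F →+ AddCircle (1 : ℚ))
      map_add' := by
        intro c c'
        refine DFunLike.ext _ _ fun x => ?_
        change χ _ = χ _ + χ _
        rw [← map_add]; congr 1; ext j; exact tmk_add_left _ _ _
      map_smul' := by
        intro s c
        refine DFunLike.ext _ _ fun x => ?_
        change χ _ = χ _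
        congr 1; ext j; exact tmk_balanced _ _ _ }
  have hφ : ∀ c x, φ c x = χ (fun j => tmk R S C F (c j) x) := fun c x => rfl
  let β : (Fin m → C) →ₗ[S] (Fin l → C) :=
    { toFun := fun c p => ∑ j, b p j • c j
      map_add' := by intro c c'; ext p; simp [smul_add, Finset.sum_add_distrib]
      map_smul' := by
        intro s c; ext p
        simp [Finset.smul_sum, smul_comm s] }
  have hker : LinearMap.ker β ≤ LinearMap.ker φ := by
    intro c hc
    obtain ⟨z, hz⟩ := h c (fun p => congrFun hc p)
    refine DFunLike.ext _ _ fun x => ?_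
    rw [hφ]
    have : (fun j => tmk R S C F (c j) x) = α (fun i => tmk R S C F (z i) x) := by
      ext j
      change _ = ∑ i, a j i • _
      rw [hz j, tmk_sum]
      simp only [tmk_smul]
    rw [this, hχα]; rfl
  have hinj : Function.Injective ((LinearMap.ker β).liftQ β le_rfl) := by
    rw [← LinearMap.ker_eq_bot]; exact Submodule.ker_liftQ_eq_bot _ _ _ le_rfl
  have : Module.Injective S (CharMod F) := hF
  obtain ⟨ψ, hψ⟩ := Module.Injective.extension_property S (CharMod F) _ _
    ((LinearMap.ker β).liftQ β le_rfl) hinj ((LinearMap.ker β).liftQ φ hker)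
  have hψβ : ∀ c, ψ (β c) = φ c := fun c =>
    LinearMap.congr_fun hψ ((LinearMap.ker β).mkQ c)
  choose ξ hξ using fun p : Fin l => exists_char (R := R) (ψ ∘ₗ LinearMap.single S (fun _ => C) p)
  let χ' : (Fin l → tensNC R S C F) →+ AddCircle (1 : ℚ) :=
    ∑ p, (ξ p).comp (Pi.evalAddMonoidHom _ p)
  have hχ' : ∀ t, χ' t = ∑ p, ξ p (t p) := fun t => by simp [χ']
  have hχ'ψ : ∀ (c : Fin l → C) x, χ' (fun p => tmk R S C F (c p) x) = ψ c x := by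
    intro c x
    rw [hχ']
    simp only [hξ]
    have h1 : c = ∑ p, Pi.single p (c p) := (Finset.univ_sum_single c).symm
    conv_rhs => rw [h1, map_sum]
    let ev : CharMod F →+ AddCircle (1 : ℚ) := AddMonoidHom.mk' (fun g => g x) fun _ _ => rfl
    exact (map_sum ev _ _).symm
  let βT : (Fin m → tensNC R S C F) →+ (Fin l → tensNC R S C F) :=
    AddMonoidHom.mk' (fun z p => ∑ j, b p j • z j) (by
      intro z z'; ext j; simp [smul_add, Finset.sum_add_distrib])
  have hfin : χ = χ'.comp βT := by
    refine AddMonoidHom.functions_ext' _ _ _ fun j => ?_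
    refine tensNC_hom_ext _ _ fun c x => ?_
    have e1 : Pi.single j (tmk R S C F c x) =
        fun j' => tmk R S C F ((Pi.single j c : Fin m → C) j') x := by
      ext j'
      by_cases hj : j' = j
      · subst hj; simp
      · simp [hj, tmk_zero_left]
    have e2 : βT (fun j' => tmk R S C F ((Pi.single j c : Fin m → C) j') x) =
        fun p => tmk R S C F (β (Pi.single j c) p) x := by
      ext p
      change ∑ j, b p j • _ = tmk R S C F (∑ j, b p j • _) x
      rw [tmk_sum]; simp only [tmk_smul]
    change χ (Pi.single j (tmk R S C F c x)) = χ' (βT (Pi.single j (tmk R S C F c x)))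
    rw [e1, e2, hχ'ψ, hψβ, hφ]
  apply hχy
  rw [hfin, AddMonoidHom.comp_apply]
  have : βT y = 0 := by ext p; exact hy p
  rw [this, map_zero]

lemma ext_tens (hF : FlatRight S F) [IsNoetherianRing Rᵐᵒᵖ] (n : ℕ) (M : Type) [AddCommGroup M]
    [Module Rᵐᵒᵖ M] [Module.Finite Rᵐᵒᵖ M]
    (h : Subsingleton (Abelian.Ext (ModuleCat.of Rᵐᵒᵖ M) (ModuleCat.of Rᵐᵒᵖ C) (n+1))) :
    Subsingleton (Abelian.Ext (ModuleCat.of Rᵐᵒᵖ M)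
      (ModuleCat.of Rᵐᵒᵖ (tensNC R S C F)) (n+1)) := by
  induction n generalizing M with
  | zero =>
    obtain ⟨k, p, hp⟩ := Module.Finite.exists_fin' Rᵐᵒᵖ M
    obtain ⟨m, l, a, b, hab⟩ := exists_matrices p
    rw [zero_add, ext_one_ker p hp, hab] at h ⊢
    exact matExact_tens hF a b h
  | succ n ih =>
    obtain ⟨k, p, hp⟩ := Module.Finite.exists_fin' Rᵐᵒᵖ M
    have hS := LinearMap.shortExact_shortComplexKer hp
    have : Projective p.shortComplexKer.X₂ :=
      inferInstanceAs (Projective (ModuleCat.of Rᵐᵒᵖ (Fin k → Rᵐᵒᵖ)))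
    exact (ext_shift_left hS _ n).2 (ih (LinearMap.ker p) ((ext_shift_left hS _ n).1 h))

end

theorem stmt17 (R : Type) [Ring R] (S : Type) [Ring S]
    (C : Type) [AddCommGroup C] [Module Rᵐᵒᵖ C] [Module S C] [SMulCommClass S Rᵐᵒᵖ C]
    (F : Type) [AddCommGroup F] [Module Sᵐᵒᵖ F]
    (hnoeth : IsNoetherianRing Rᵐᵒᵖ)
    (hfg : Module.Finite Rᵐᵒᵖ C)
    (hso : ∀ i, 1 ≤ i →
      Subsingleton (extM Rᵐᵒᵖ i (ModuleCat.of Rᵐᵒᵖ C) (ModuleCat.of Rᵐᵒᵖ C)))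
    (hF : FlatRight S F) :
    (∀ (J : Type) (i : ℕ), 1 ≤ i →
      Subsingleton (extM Rᵐᵒᵖ i (ModuleCat.of Rᵐᵒᵖ (J →₀ C))
        (ModuleCat.of Rᵐᵒᵖ (tensNC R S C F)))) ∧
    (∀ n : ℕ, injDimLE Rᵐᵒᵖ (ModuleCat.of Rᵐᵒᵖ C) n →
      injDimLE Rᵐᵒᵖ (ModuleCat.of Rᵐᵒᵖ (tensNC R S C F)) n) := by
  refine ⟨fun J i hi => ?_, fun n hn => ?_⟩
  · obtain ⟨i, rfl⟩ := Nat.exists_eq_add_of_le' hi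
    rw [extM_iff_abs]
    exact ext_finsupp C J i _ (ext_tens hF i C ((extM_iff_abs _ _ _).1 (hso _ hi)))
  · have hid : HasInjectiveDimensionLE (ModuleCat.of Rᵐᵒᵖ (tensNC R S C F)) n :=
      injDim_of_ideals n _ fun I => ext_tens hF n _
        ((extM_iff_abs _ _ _).1 (hn _ _ (Nat.lt_succ_self n)))
    intro Y i hi
    obtain ⟨i, rfl⟩ := Nat.exists_eq_add_of_le' (Nat.one_le_of_lt hi)
    rw [extM_iff_abs]
    exact HasInjectiveDimensionLT.subsingleton _ (n+1) _ hi Y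
end
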